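/- arXiv:1003.4330 — 2 statements merged into one kernel-verified Lean document; each statement's English description precedes it below -/
import Mathlib

section
/- For every k ∈ ℕ, ∫_ℝ h_{2k+1}(x)² / x² dx = 2, where h_{2k+1} is the normalized Hermite function of odd degree 2k+1. -/
open MeasureTheory Real

/-- The normalized Hermite function of degree `k`:
`h_k(t) = (−1)^k (2^k k! √π)^{−1/2} e^{t²/2} (d/dt)^k(e^{−t²})`. -/
noncomputable def hermiteFun (k : ℕ) (t : ℝ) : ℝ :=
  (-1 : ℝ) ^ k * ((2 : ℝ) ^ k * (Nat.factorial k : ℝ) * Real.sqrt π) ^ (-(1 : ℝ) / 2) *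
    Real.exp (t ^ 2 / 2) * iteratedDeriv k (fun s : ℝ => Real.exp (-s ^ 2)) t

open Polynomial in
/-- The Hermite polynomials orthogonal for the weight `e^{-x²}` (leading coefficient `2 ^ n`). -/
noncomputable def physHermite : ℕ → ℝ[X]
  | 0 => 1
  | n + 1 => 2 * X * physHermite n - derivative (physHermite n)

/-- The integral of a polynomial against the weight `e^{-x²}`. -/
noncomputable def gaussianFunctional (p : Polynomial ℝ) : ℝ :=
  ∫ x : ℝ, p.eval x * Real.exp (-x ^ 2)

open Polynomial in
/-- The quotient of the Hermite polynomial of degree `2 * k + 1` by `X`. -/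
noncomputable def oddHermiteQuotient : ℕ → ℝ[X]
  | 0 => C 2
  | k + 1 => C 2 * physHermite (2 * k + 2) - C (4 * ((k : ℝ) + 1)) * oddHermiteQuotient k

section

open Polynomial

theorem physHermite_succ (n : ℕ) :
    physHermite (n + 1) = 2 * X * physHermite n - derivative (physHermite n) := rfl

theorem derivative_physHermite_succ (n : ℕ) :
    derivative (physHermite (n + 1)) = C (2 * ((n : ℝ) + 1)) * physHermite n := by
  induction n with
  | zero => simp [physHermite, ← C_ofNat]
  | succ n ih =>
    rw [physHermite_succ (n + 1), derivative_sub, derivative_mul, ih, derivative_C_mul,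
      physHermite_succ n]
    simp only [derivative_mul, derivative_X, derivative_ofNat, C_mul, C_add, Nat.cast_add,
      Nat.cast_one, C_1, C_ofNat]
    ring

theorem physHermite_add_two (n : ℕ) :
    physHermite (n + 2) =
      2 * X * physHermite (n + 1) - C (2 * ((n : ℝ) + 1)) * physHermite n := by
  rw [physHermite_succ (n + 1), derivative_physHermite_succ]

theorem X_mul_oddHermiteQuotient (k : ℕ) :
    X * oddHermiteQuotient k = physHermite (2 * k + 1) := by
  induction k with
  | zero => simp [oddHermiteQuotient, physHermite, C_ofNat, X_mul]
  | succ k ih =>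
    rw [show 2 * (k + 1) + 1 = (2 * k + 1) + 2 by ring, physHermite_add_two, ← ih,
      oddHermiteQuotient]
    simp only [C_mul, C_add, Nat.cast_add, Nat.cast_mul, Nat.cast_one, C_1, C_ofNat,
      Nat.cast_ofNat]
    ring

theorem hasDerivAt_eval_mul_exp_neg_sq (p : ℝ[X]) (x : ℝ) :
    HasDerivAt (fun x : ℝ => p.eval x * Real.exp (-x ^ 2))
      ((derivative p - 2 * X * p).eval x * Real.exp (-x ^ 2)) x := by
  have h : HasDerivAt (fun x : ℝ => Real.exp (-x ^ 2)) (Real.exp (-x ^ 2) * (-(2 * x))) x := by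
    simpa using ((hasDerivAt_pow 2 x).neg).exp
  refine ((p.hasDerivAt x).mul h).congr_deriv ?_
  simp only [eval_sub, eval_mul, eval_X, eval_ofNat]
  ring

theorem iteratedDeriv_exp_neg_sq (n : ℕ) :
    iteratedDeriv n (fun s : ℝ => Real.exp (-s ^ 2)) =
      fun x => ((-1) ^ n * physHermite n).eval x * Real.exp (-x ^ 2) := by
  induction n with
  | zero => simp [physHermite]
  | succ n ih =>
    rw [iteratedDeriv_succ, ih]
    ext x
    rw [(hasDerivAt_eval_mul_exp_neg_sq _ x).deriv]
    congr 2
    have h : derivative ((-1 : ℝ[X]) ^ n) = 0 := by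
      simp
    rw [derivative_mul, h, physHermite_succ]
    ring

theorem integrable_eval_mul_exp_neg_sq (p : ℝ[X]) :
    Integrable (fun x : ℝ => p.eval x * Real.exp (-x ^ 2)) := by
  induction p using Polynomial.induction_on' with
  | add p q hp hq =>
    simp only [eval_add, add_mul]
    exact hp.add hq
  | monomial n a =>
    have h := integrable_rpow_mul_exp_neg_mul_sq (b := 1) one_pos (s := n)
      (by linarith [n.cast_nonneg (α := ℝ)])
    simpa [mul_assoc] using h.const_mul a

theorem gaussianFunctional_sub (p q : ℝ[X]) :
    gaussianFunctional (p - q) = gaussianFunctional p - gaussianFunctional q := by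
  simp only [gaussianFunctional, eval_sub, sub_mul]
  exact integral_sub (integrable_eval_mul_exp_neg_sq p) (integrable_eval_mul_exp_neg_sq q)

theorem gaussianFunctional_C_mul (a : ℝ) (p : ℝ[X]) :
    gaussianFunctional (C a * p) = a * gaussianFunctional p := by
  simp only [gaussianFunctional, eval_mul, eval_C, mul_assoc]
  exact integral_const_mul _ _

theorem gaussianFunctional_one : gaussianFunctional 1 = √π := by
  simpa [gaussianFunctional] using integral_gaussian 1

theorem gaussianFunctional_derivative (p : ℝ[X]) :
    gaussianFunctional (derivative p - 2 * X * p) = 0 :=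
  integral_eq_zero_of_hasDerivAt_of_integrable (hasDerivAt_eval_mul_exp_neg_sq p)
    (integrable_eval_mul_exp_neg_sq _) (integrable_eval_mul_exp_neg_sq _)

theorem gaussianFunctional_physHermite_succ_mul (n : ℕ) (q : ℝ[X]) :
    gaussianFunctional (physHermite (n + 1) * q) =
      gaussianFunctional (physHermite n * derivative q) := by
  have h := gaussianFunctional_derivative (physHermite n * q)
  have e : derivative (physHermite n * q) - 2 * X * (physHermite n * q) =
      physHermite n * derivative q - physHermite (n + 1) * q := by
    rw [derivative_mul, physHermite_succ]
    ring
  rw [e, gaussianFunctional_sub] at h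
  linarith

theorem gaussianFunctional_physHermite_succ_mul_succ (m n : ℕ) :
    gaussianFunctional (physHermite (m + 1) * physHermite (n + 1)) =
      2 * ((n : ℝ) + 1) * gaussianFunctional (physHermite m * physHermite n) := by
  rw [gaussianFunctional_physHermite_succ_mul, derivative_physHermite_succ, mul_left_comm,
    gaussianFunctional_C_mul]

theorem gaussianFunctional_physHermite_mul_self (n : ℕ) :
    gaussianFunctional (physHermite n * physHermite n) = 2 ^ n * (n.factorial : ℝ) * √π := by
  induction n with
  | zero => simp [physHermite, gaussianFunctional_one]
  | succ n ih =>
    rw [gaussianFunctional_physHermite_succ_mul_succ, ih, Nat.factorial_succ]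
    push_cast
    ring

theorem gaussianFunctional_physHermite_mul_eq_zero {m n : ℕ} (h : n < m) :
    gaussianFunctional (physHermite m * physHermite n) = 0 := by
  induction n generalizing m with
  | zero =>
    obtain ⟨m, rfl⟩ := Nat.exists_eq_add_of_lt h
    rw [gaussianFunctional_physHermite_succ_mul]
    simp [physHermite, gaussianFunctional]
  | succ n ih =>
    obtain ⟨m, rfl⟩ : ∃ j, m = j + 1 := ⟨m - 1, by omega⟩
    rw [gaussianFunctional_physHermite_succ_mul_succ, ih (by omega), mul_zero]

theorem gaussianFunctional_physHermite_mul_oddHermiteQuotient {m k : ℕ} (h : 2 * k < m) :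
    gaussianFunctional (physHermite m * oddHermiteQuotient k) = 0 := by
  induction k with
  | zero =>
    have := gaussianFunctional_physHermite_mul_eq_zero h
    rw [oddHermiteQuotient, mul_comm, gaussianFunctional_C_mul]
    simp_all [physHermite]
  | succ k ih =>
    rw [oddHermiteQuotient, mul_sub, gaussianFunctional_sub, mul_left_comm,
      gaussianFunctional_C_mul, mul_left_comm, gaussianFunctional_C_mul, ih (by omega),
      gaussianFunctional_physHermite_mul_eq_zero (by omega)]
    simp

theorem gaussianFunctional_oddHermiteQuotient_mul_self (k : ℕ) :
    gaussianFunctional (oddHermiteQuotient k * oddHermiteQuotient k) =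
      2 * (2 ^ (2 * k + 1) * ((2 * k + 1).factorial : ℝ) * √π) := by
  induction k with
  | zero =>
    rw [oddHermiteQuotient, gaussianFunctional_C_mul, ← mul_one (C (2 : ℝ)),
      gaussianFunctional_C_mul, gaussianFunctional_one]
    norm_num
  | succ k ih =>
    have e : oddHermiteQuotient (k + 1) * oddHermiteQuotient (k + 1) =
        C 4 * (physHermite (2 * k + 2) * physHermite (2 * k + 2)) -
          C (16 * ((k : ℝ) + 1)) * (physHermite (2 * k + 2) * oddHermiteQuotient k) -
          C (-(16 * ((k : ℝ) + 1) ^ 2)) * (oddHermiteQuotient k * oddHermiteQuotient k) := by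
      rw [oddHermiteQuotient]
      simp only [C_mul, C_add, C_neg, C_pow, C_1, C_ofNat]
      ring
    rw [e, gaussianFunctional_sub, gaussianFunctional_sub, gaussianFunctional_C_mul,
      gaussianFunctional_C_mul, gaussianFunctional_C_mul, ih,
      gaussianFunctional_physHermite_mul_self,
      gaussianFunctional_physHermite_mul_oddHermiteQuotient (by omega),
      show 2 * (k + 1) + 1 = 2 * k + 1 + 1 + 1 by ring, Nat.factorial_succ (2 * k + 1 + 1),
      Nat.factorial_succ (2 * k + 1)]
    push_cast
    ring

theorem hermiteFun_sq (n : ℕ) (x : ℝ) :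
    hermiteFun n x ^ 2 = (2 ^ n * (n.factorial : ℝ) * √π)⁻¹ *
      ((physHermite n).eval x ^ 2 * Real.exp (-x ^ 2)) := by
  have hc : 0 ≤ (2 : ℝ) ^ n * (n.factorial : ℝ) * √π := by positivity
  have h1 : (((2 : ℝ) ^ n * (n.factorial : ℝ) * √π) ^ (-(1 : ℝ) / 2)) ^ 2 =
      (2 ^ n * (n.factorial : ℝ) * √π)⁻¹ := by
    rw [← Real.rpow_natCast, ← Real.rpow_mul hc, ← Real.rpow_neg_one]
    norm_num
  have h2 : Real.exp (x ^ 2 / 2) ^ 2 * Real.exp (-x ^ 2) ^ 2 = Real.exp (-x ^ 2) := by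
    rw [← Real.exp_nat_mul, ← Real.exp_nat_mul, ← Real.exp_add]
    congr 1
    push_cast
    ring
  have h3 : ((-1 : ℝ) ^ n) ^ 2 = 1 := by rw [← pow_mul, mul_comm, pow_mul]; simp
  rw [hermiteFun, iteratedDeriv_exp_neg_sq, ← h1, ← h2]
  simp only [mul_pow, eval_mul, eval_pow, eval_neg, eval_one, h3]
  ring

end

theorem odd_hermite_singular_integral (k : ℕ) :
    ∫ x : ℝ, (hermiteFun (2 * k + 1) x) ^ 2 / x ^ 2 = 2 := by
  set c : ℝ := 2 ^ (2 * k + 1) * ((2 * k + 1).factorial : ℝ) * √π with hc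
  have hc0 : c ≠ 0 := by positivity
  have hae : (fun x : ℝ => (hermiteFun (2 * k + 1) x) ^ 2 / x ^ 2) =ᵐ[volume]
      fun x => c⁻¹ *
        ((oddHermiteQuotient k * oddHermiteQuotient k).eval x * Real.exp (-x ^ 2)) := by
    filter_upwards [Measure.ae_ne volume (0 : ℝ)] with x hx
    rw [hermiteFun_sq, ← X_mul_oddHermiteQuotient, ← hc]
    simp only [Polynomial.eval_mul, Polynomial.eval_X]
    field_simp
  have hQ := gaussianFunctional_oddHermiteQuotient_mul_self k
  rw [gaussianFunctional, ← hc] at hQ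
  rw [integral_congr_ae hae, integral_const_mul, hQ]
  field_simp
end

section
/- Writing V_{2k} = ∫₀^∞ (∫_x^∞ h_{2k}(t) dt)² dx, the recursion V_{2k+2} = −1/(2k+2) + (√2/(k+1)) · Σ_{i=0}^k C(−1/2, i) + ((2k+1)/(2k+2)) · V_{2k} holds for every k ∈ ℕ. -/
open MeasureTheory Real

/-- Generalized binomial coefficient `C(a,i) = a(a−1)⋯(a−i+1)/i!`. -/
noncomputable def genBinom (a : ℝ) (i : ℕ) : ℝ :=
  (∏ j ∈ Finset.range i, (a - j)) / (Nat.factorial i : ℝ)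

/-- `V_{2k} = ∫₀^∞ (∫_x^∞ h_{2k}(t) dt)² dx`. -/
noncomputable def Veven (k : ℕ) : ℝ :=
  ∫ x in Set.Ioi (0 : ℝ), (∫ t in Set.Ioi x, hermiteFun (2 * k) t) ^ 2

open Set Filter Asymptotics

/-- The derivative recursion `D^{n+1} = -2x D^n - 2n D^{n-1}` for `e^{-x²}`. -/
theorem iteratedDeriv_exp_neg_sq_succ (n : ℕ) (x : ℝ) :
    iteratedDeriv (n + 1) (fun s : ℝ => Real.exp (-s ^ 2)) x
      = -2 * x * iteratedDeriv n (fun s : ℝ => Real.exp (-s ^ 2)) x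
        - 2 * n * iteratedDeriv (n - 1) (fun s : ℝ => Real.exp (-s ^ 2)) x := by
  have hd : ∀ m (y : ℝ), HasDerivAt (iteratedDeriv m (fun s : ℝ => Real.exp (-s ^ 2)))
      (iteratedDeriv (m + 1) (fun s : ℝ => Real.exp (-s ^ 2)) y) y := by
    intro m y
    rw [iteratedDeriv_succ]
    have hc : ContDiff ℝ (m + 1) (fun s : ℝ => Real.exp (-s ^ 2)) := by fun_prop
    exact (hc.differentiable_iteratedDeriv m (by exact_mod_cast Nat.lt_succ_self m) y).hasDerivAt
  induction n generalizing x with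
  | zero =>
    have h : HasDerivAt (fun s : ℝ => Real.exp (-s ^ 2)) (Real.exp (-x ^ 2) * (-(2 * x))) x := by
      simpa using ((hasDerivAt_pow 2 x).neg).exp
    simp only [zero_add, iteratedDeriv_one, iteratedDeriv_zero, h.deriv]
    push_cast
    ring
  | succ n ih =>
    rw [iteratedDeriv_succ, funext ih]
    have h2 : HasDerivAt (fun y : ℝ => 2 * (n : ℝ) *
        iteratedDeriv (n - 1) (fun s : ℝ => Real.exp (-s ^ 2)) y)
        (2 * n * iteratedDeriv n (fun s : ℝ => Real.exp (-s ^ 2)) x) x := by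
      rcases n with _ | n
      · simpa using hasDerivAt_const x (0 : ℝ)
      · exact (hd n x).const_mul _
    have h1 := ((hasDerivAt_id x).const_mul (-2 : ℝ)).mul (hd n x)
    have h3 := (h1.sub h2).deriv
    simp only [id, Pi.mul_def, Pi.sub_def] at h3
    rw [h3]
    simp only [Nat.add_sub_cancel, ih x]
    push_cast
    ring

/-- The normalising constants satisfy `√(2(n+1)) c_{n+1} = c_n`. -/
theorem sqrt_mul_hermite_normalization (n : ℕ) :
    √(2 * (n + 1)) * ((2 : ℝ) ^ (n + 1) * ((n + 1).factorial : ℝ) * √π) ^ (-(1 : ℝ) / 2)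
      = ((2 : ℝ) ^ n * (n.factorial : ℝ) * √π) ^ (-(1 : ℝ) / 2) := by
  have h : (2 : ℝ) ^ (n + 1) * ((n + 1).factorial : ℝ) * √π
      = (2 * (n + 1)) * ((2 : ℝ) ^ n * (n.factorial : ℝ) * √π) := by
    rw [Nat.factorial_succ]; push_cast; ring
  have hp : (0 : ℝ) < 2 * (n + 1) := by positivity
  rw [h, Real.mul_rpow hp.le (by positivity), ← mul_assoc, Real.sqrt_eq_rpow, ← Real.rpow_add hp]
  norm_num

theorem hasDerivAt_hermiteFun (n : ℕ) (t : ℝ) :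
    HasDerivAt (hermiteFun n) (t * hermiteFun n t - √(2 * (n + 1)) * hermiteFun (n + 1) t) t := by
  have hc : ContDiff ℝ (n + 1) (fun s : ℝ => Real.exp (-s ^ 2)) := by fun_prop
  have hd : HasDerivAt (iteratedDeriv n (fun s : ℝ => Real.exp (-s ^ 2)))
      (iteratedDeriv (n + 1) (fun s : ℝ => Real.exp (-s ^ 2)) t) t := by
    rw [iteratedDeriv_succ]
    exact (hc.differentiable_iteratedDeriv n (by exact_mod_cast Nat.lt_succ_self n) t).hasDerivAt
  have he : HasDerivAt (fun s : ℝ => Real.exp (s ^ 2 / 2)) (Real.exp (t ^ 2 / 2) * t) t := by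
    have := ((hasDerivAt_pow 2 t).div_const 2).exp
    simpa using this
  have := (he.const_mul ((-1 : ℝ) ^ n *
    ((2 : ℝ) ^ n * (n.factorial : ℝ) * √π) ^ (-(1 : ℝ) / 2))).mul hd
  refine HasDerivAt.congr_deriv (f := hermiteFun n) this ?_
  unfold hermiteFun
  rw [← sqrt_mul_hermite_normalization n]
  ring

/-- The three-term recursion of the Hermite functions. -/
theorem hermiteFun_three_term (n : ℕ) (t : ℝ) :
    √(2 * (n + 2)) * hermiteFun (n + 2) t
      = 2 * t * hermiteFun (n + 1) t - √(2 * (n + 1)) * hermiteFun n t := by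
  have h1 := sqrt_mul_hermite_normalization n
  have h2 := sqrt_mul_hermite_normalization (n + 1)
  have hs : √(2 * ((n : ℝ) + 1)) ^ 2 = 2 * (n + 1) := Real.sq_sqrt (by positivity)
  have hD := iteratedDeriv_exp_neg_sq_succ (n + 1) t
  push_cast at h2 hD
  rw [show (n : ℝ) + 1 + 1 = n + 2 by ring] at h2
  unfold hermiteFun
  rw [hD, ← h1, ← h2]
  linear_combination (-(-1) ^ n * √(2 * ((n : ℝ) + 2)) *
    (2 ^ (n + 2) * ((n + 2).factorial : ℝ) * √π) ^ (-(1 : ℝ) / 2) * Real.exp (t ^ 2 / 2) *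
    iteratedDeriv n (fun s : ℝ => Real.exp (-s ^ 2)) t) * (-hs)

theorem hermiteFun_zero (t : ℝ) :
    hermiteFun 0 t = √π ^ (-(1 : ℝ) / 2) * Real.exp (-(1 / 2) * t ^ 2) := by
  simp only [hermiteFun, iteratedDeriv_zero, pow_zero, Nat.factorial_zero, Nat.cast_one, one_mul]
  rw [mul_assoc, ← Real.exp_add]
  ring_nf

theorem hermiteFun_one (t : ℝ) : √2 * hermiteFun 1 t = 2 * t * hermiteFun 0 t := by
  have h1 := sqrt_mul_hermite_normalization 0
  have hD := iteratedDeriv_exp_neg_sq_succ 0 t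
  simp only [Nat.cast_zero, zero_add, mul_one] at h1 hD
  unfold hermiteFun
  rw [hD, ← h1]
  simp
  ring

theorem continuous_hermiteFun (n : ℕ) : Continuous (hermiteFun n) :=
  continuous_iff_continuousAt.2 fun t => (hasDerivAt_hermiteFun n t).continuousAt

theorem hasDerivAt_hermiteFun_succ (n : ℕ) (t : ℝ) :
    HasDerivAt (hermiteFun (n + 1))
      ((√(2 * (n + 1)) * hermiteFun n t - √(2 * (n + 2)) * hermiteFun (n + 2) t) / 2) t := by
  convert hasDerivAt_hermiteFun (n + 1) t using 1
  have := hermiteFun_three_term n t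
  push_cast
  rw [show (n : ℝ) + 1 + 1 = n + 2 by ring]
  linarith

/-- Continuous functions on `ℝ` that are `O(e^{-x})` at `+∞`. -/
def ExpDecay (f : ℝ → ℝ) : Prop :=
  Continuous f ∧ f =O[atTop] fun x : ℝ => Real.exp (-x)

namespace ExpDecay

variable {f g : ℝ → ℝ}

theorem integrableOn (hf : ExpDecay f) (a : ℝ) : IntegrableOn f (Ioi a) :=
  integrable_of_isBigO_exp_neg one_pos hf.1.continuousOn (by simpa using hf.2)

theorem tendsto (hf : ExpDecay f) : Tendsto f atTop (nhds 0) :=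
  hf.2.trans_tendsto (Real.tendsto_exp_neg_atTop_nhds_zero)

theorem add (hf : ExpDecay f) (hg : ExpDecay g) : ExpDecay fun x => f x + g x :=
  ⟨hf.1.add hg.1, hf.2.add hg.2⟩

theorem sub (hf : ExpDecay f) (hg : ExpDecay g) : ExpDecay fun x => f x - g x :=
  ⟨hf.1.sub hg.1, hf.2.sub hg.2⟩

theorem const_mul (c : ℝ) (hf : ExpDecay f) : ExpDecay fun x => c * f x :=
  ⟨hf.1.const_mul c, hf.2.const_mul_left c⟩

theorem mul (hf : ExpDecay f) (hg : ExpDecay g) : ExpDecay fun x => f x * g x := by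
  refine ⟨hf.1.mul hg.1, ?_⟩
  simpa using hf.2.mul (hg.tendsto.isBigO_one ℝ)

theorem integral_deriv {f' : ℝ → ℝ} (hf : ExpDecay f) (hf' : ExpDecay f')
    (h : ∀ x, HasDerivAt f (f' x) x) (a : ℝ) : ∫ x in Ioi a, f' x = -f a := by
  rw [integral_Ioi_of_hasDerivAt_of_tendsto' (fun x _ => h x) (hf'.integrableOn a) hf.tendsto]
  ring

theorem hasDerivAt_tail (hf : ExpDecay f) (x : ℝ) :
    HasDerivAt (fun y => ∫ t in Ioi y, f t) (-f x) x := by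
  have h : (fun y => ∫ t in Ioi y, f t) = fun y => (∫ t in Ioi 0, f t) - ∫ t in (0 : ℝ)..y, f t := by
    funext y
    have := intervalIntegral.integral_Ioi_sub_Ioi' (hf.integrableOn 0) (hf.integrableOn y)
    rw [← this]; ring
  rw [h]
  exact (intervalIntegral.integral_hasDerivAt_right (hf.1.intervalIntegrable _ _)
    (hf.1.stronglyMeasurableAtFilter _ _) hf.1.continuousAt).const_sub _

theorem tail (hf : ExpDecay f) : ExpDecay fun y => ∫ t in Ioi y, f t := by
  refine ⟨continuous_iff_continuousAt.2 fun x => (hf.hasDerivAt_tail x).continuousAt, ?_⟩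
  obtain ⟨C, hC⟩ := hf.2.bound
  obtain ⟨a, ha⟩ := eventually_atTop.1 hC
  refine IsBigO.of_bound C (eventually_atTop.2 ⟨a, fun x hx => ?_⟩)
  calc ‖∫ t in Ioi x, f t‖ ≤ ∫ t in Ioi x, C * Real.exp (-t) := by
        refine norm_integral_le_of_norm_le ((integrableOn_exp_neg_Ioi x).const_mul C) ?_
        filter_upwards [ae_restrict_mem measurableSet_Ioi] with t ht
        simpa using ha t (hx.trans ht.le)
    _ = C * ‖Real.exp (-x)‖ := by
        rw [integral_const_mul, integral_exp_neg_Ioi]; simp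

end ExpDecay

theorem hermiteFun_isBigO (n : ℕ) (b : ℝ) :
    hermiteFun n =O[atTop] fun x : ℝ => Real.exp (-b * x) := by
  have hx : ∀ (m : ℕ), (∀ b : ℝ, hermiteFun m =O[atTop] fun x : ℝ => Real.exp (-b * x)) →
      ∀ b : ℝ, (fun x => 2 * x * hermiteFun m x) =O[atTop] fun x : ℝ => Real.exp (-b * x) := by
    intro m hm b
    have h1 : (fun x : ℝ => x) =O[atTop] fun x : ℝ => Real.exp x := by
      simpa using (isLittleO_pow_exp_atTop (n := 1)).isBigO
    have h2 := (h1.const_mul_left 2).mul (hm (b + 1))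
    refine h2.congr_right fun x => ?_
    rw [← Real.exp_add]; ring_nf
  have hz : ∀ b : ℝ, hermiteFun 0 =O[atTop] fun x : ℝ => Real.exp (-b * x) := by
    intro b
    refine IsBigO.of_bound (√π ^ (-(1 : ℝ) / 2) * Real.exp (b ^ 2 / 2)) (.of_forall fun x => ?_)
    rw [hermiteFun_zero, Real.norm_of_nonneg (by positivity), Real.norm_of_nonneg (by positivity),
      mul_assoc, ← Real.exp_add]
    gcongr
    nlinarith [sq_nonneg (x - b)]
  induction n using Nat.twoStepInduction generalizing b with
  | zero => exact hz b
  | one =>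
    refine ((hx 0 hz b).const_mul_left (√2)⁻¹).congr_left fun x => ?_
    rw [← hermiteFun_one, inv_mul_cancel_left₀ (by positivity)]
  | more n h0 h1 =>
    refine (((hx _ h1 b).sub ((h0 b).const_mul_left (√(2 * (n + 1))))).const_mul_left
      (√(2 * (n + 2)))⁻¹).congr_left fun x => ?_
    rw [← hermiteFun_three_term, inv_mul_cancel_left₀ (by positivity)]

theorem expDecay_hermiteFun (n : ℕ) : ExpDecay (hermiteFun n) :=
  ⟨continuous_hermiteFun n, by simpa using hermiteFun_isBigO n 1⟩

/-- The tail integral `∫_x^∞ h_n`. -/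
noncomputable def hermiteTail (n : ℕ) (x : ℝ) : ℝ :=
  ∫ t in Ioi x, hermiteFun n t

theorem expDecay_hermiteTail (n : ℕ) : ExpDecay (hermiteTail n) :=
  (expDecay_hermiteFun n).tail

theorem hasDerivAt_hermiteTail (n : ℕ) (x : ℝ) :
    HasDerivAt (hermiteTail n) (-hermiteFun n x) x :=
  (expDecay_hermiteFun n).hasDerivAt_tail x

theorem hermiteTail_add_two (n : ℕ) (x : ℝ) :
    √(2 * (n + 2)) * hermiteTail (n + 2) x
      = √(2 * (n + 1)) * hermiteTail n x + 2 * hermiteFun (n + 1) x := by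
  have h0 := (expDecay_hermiteFun n).const_mul √(2 * (n + 1))
  have h2 := (expDecay_hermiteFun (n + 2)).const_mul √(2 * (n + 2))
  have h := (expDecay_hermiteFun (n + 1)).integral_deriv ((h0.sub h2).const_mul (1 / 2))
    (fun y => (hasDerivAt_hermiteFun_succ n y).congr_deriv (by ring)) x
  rw [integral_const_mul, integral_sub (h0.integrableOn x) (h2.integrableOn x),
    integral_const_mul, integral_const_mul] at h
  unfold hermiteTail
  linarith

theorem hermiteFun_odd_zero (k : ℕ) : hermiteFun (2 * k + 1) 0 = 0 := by
  induction k with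
  | zero => simpa using hermiteFun_one 0
  | succ k ih =>
    have h := hermiteFun_three_term (2 * k + 1) 0
    rw [ih, mul_zero, mul_zero, zero_mul, sub_zero] at h
    exact (mul_eq_zero.1 h).resolve_left (by positivity)

theorem hermiteFun_zero_mul_succ_zero (n : ℕ) : hermiteFun n 0 * hermiteFun (n + 1) 0 = 0 := by
  obtain ⟨k, rfl | rfl⟩ := n.even_or_odd'
  · rw [hermiteFun_odd_zero, mul_zero]
  · rw [hermiteFun_odd_zero, zero_mul]

theorem integral_hermiteFun_sq (n : ℕ) :
    ∫ x in Ioi (0 : ℝ), hermiteFun n x * hermiteFun n x = 1 / 2 := by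
  induction n with
  | zero =>
    have h : ∀ x, hermiteFun 0 x * hermiteFun 0 x = (√π)⁻¹ * Real.exp (-1 * x ^ 2) := by
      intro x
      rw [hermiteFun_zero, mul_mul_mul_comm, ← Real.rpow_add (by positivity), ← Real.exp_add]
      rw [show -(1 : ℝ) / 2 + -(1 : ℝ) / 2 = -1 by norm_num, Real.rpow_neg_one]
      ring_nf
    simp_rw [h]
    rw [integral_const_mul, integral_gaussian_Ioi, div_one]
    field_simp
  | succ n ih =>
    have e0 := (expDecay_hermiteFun n).mul (expDecay_hermiteFun n)
    have e1 := (expDecay_hermiteFun (n + 1)).mul (expDecay_hermiteFun (n + 1))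
    have h := ((expDecay_hermiteFun n).mul (expDecay_hermiteFun (n + 1))).integral_deriv
      ((e0.sub e1).const_mul √(2 * (n + 1)))
      (fun x => by
        refine ((hasDerivAt_hermiteFun n x).mul (hasDerivAt_hermiteFun_succ n x)).congr_deriv ?_
        have := hermiteFun_three_term n x
        linear_combination (-hermiteFun n x / 2) * this) 0
    rw [integral_const_mul, integral_sub (e0.integrableOn 0) (e1.integrableOn 0), ih,
      hermiteFun_zero_mul_succ_zero, neg_zero] at h
    have := (mul_eq_zero.1 h).resolve_left (by positivity)
    linarith

theorem hermiteFun_mul_hermiteTail_zero (k : ℕ) :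
    hermiteFun (2 * k) 0 * hermiteTail (2 * k) 0 = √2 / 2 * genBinom (-(1 / 2)) k := by
  induction k with
  | zero =>
    simp only [hermiteTail, mul_zero, hermiteFun_zero]
    rw [integral_const_mul, integral_gaussian_Ioi, mul_right_comm, ← mul_assoc,
      ← Real.rpow_add (by positivity)]
    have : √(π / (1 / 2)) = √2 * √π := by
      rw [← Real.sqrt_mul (by norm_num)]; congr 1; ring
    rw [this]
    norm_num [Real.rpow_neg_one, genBinom]
    field_simp
  | succ k ih =>
    have hT := hermiteTail_add_two (2 * k) 0
    have hF := hermiteFun_three_term (2 * k) 0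
    have hg : genBinom (-(1 / 2)) (k + 1) * (k + 1) = genBinom (-(1 / 2)) k * (-(1 / 2) - k) := by
      simp only [genBinom, Finset.prod_range_succ, Nat.factorial_succ]
      push_cast
      field_simp
    rw [hermiteFun_odd_zero] at hT hF
    push_cast at hT hF
    have s1 : √(2 * (2 * (k : ℝ) + 1)) ^ 2 = 2 * (2 * k + 1) := Real.sq_sqrt (by positivity)
    have s2 : √(2 * (2 * (k : ℝ) + 2)) ^ 2 = 2 * (2 * k + 2) := Real.sq_sqrt (by positivity)
    have hp := congrArg₂ (· * ·) hF hT
    rw [show 2 * (k + 1) = 2 * k + 2 by ring]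
    have hk : (0 : ℝ) < 2 * (2 * k + 2) := by positivity
    refine mul_left_cancel₀ hk.ne' ?_
    linear_combination hp - s2 * (hermiteFun (2 * k + 2) 0 * hermiteTail (2 * k + 2) 0)
      - s1 * (hermiteFun (2 * k) 0 * hermiteTail (2 * k) 0) - 2 * (2 * k + 1) * ih - 2 * √2 * hg

/-- The mixed integrals `√(2(2k+1)) ∫₀^∞ F_{2k} h_{2k+1}`, where `F_n` is the tail of `h_n`. -/
theorem integral_hermiteTail_mul_hermiteFun_succ (k : ℕ) :
    √(2 * (2 * k + 1)) * ∫ x in Ioi (0 : ℝ), hermiteTail (2 * k) x * hermiteFun (2 * k + 1) x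
      = -1 + √2 * ∑ i ∈ Finset.range (k + 1), genBinom (-(1 / 2)) i := by
  induction k with
  | zero =>
    have eT := (expDecay_hermiteTail 0).mul (expDecay_hermiteFun 1)
    have eF := (expDecay_hermiteFun 0).mul (expDecay_hermiteFun 0)
    have h := ((expDecay_hermiteTail 0).mul (expDecay_hermiteFun 0)).integral_deriv
      ((eT.const_mul (-(√2 / 2))).sub eF)
      (fun x => by
        refine ((hasDerivAt_hermiteTail 0 x).mul (hasDerivAt_hermiteFun 0 x)).congr_deriv ?_
        have := hermiteFun_one x
        norm_num
        linear_combination (-hermiteTail 0 x / 2) * this) 0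
    rw [integral_sub ((eT.const_mul _).integrableOn 0) (eF.integrableOn 0), integral_const_mul,
      integral_hermiteFun_sq] at h
    have h0 := hermiteFun_mul_hermiteTail_zero 0
    simp only [mul_zero] at h0
    norm_num at h h0 ⊢
    linear_combination -2 * h + 2 * h0
  | succ k ih =>
    have eT := (expDecay_hermiteTail (2 * k)).mul (expDecay_hermiteFun (2 * k + 1))
    have eU := (expDecay_hermiteTail (2 * k + 2)).mul (expDecay_hermiteFun (2 * k + 3))
    have eF := (expDecay_hermiteFun (2 * k + 2)).mul (expDecay_hermiteFun (2 * k + 2))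
    have eG := (expDecay_hermiteFun (2 * k + 1)).mul (expDecay_hermiteFun (2 * k + 1))
    have e1 := eT.const_mul (√(2 * (2 * k + 1)) / 2)
    have e2 := eU.const_mul (√(2 * (2 * k + 3)) / 2)
    have h := ((expDecay_hermiteTail (2 * k + 2)).mul
      (expDecay_hermiteFun (2 * k + 2))).integral_deriv (((e1.add eG).sub e2).sub eF)
      (fun x => by
        refine ((hasDerivAt_hermiteTail (2 * k + 2) x).mul
          (hasDerivAt_hermiteFun_succ (2 * k + 1) x)).congr_deriv ?_
        have := hermiteTail_add_two (2 * k) x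
        push_cast at this ⊢
        ring_nf at this ⊢
        linear_combination (hermiteFun (1 + k * 2) x / 2) * this) 0
    rw [integral_sub (((e1.add eG).sub e2).integrableOn 0) (eF.integrableOn 0),
      integral_sub ((e1.add eG).integrableOn 0) (e2.integrableOn 0),
      integral_add (e1.integrableOn 0) (eG.integrableOn 0), integral_const_mul,
      integral_const_mul, integral_hermiteFun_sq, integral_hermiteFun_sq] at h
    have h0 := hermiteFun_mul_hermiteTail_zero (k + 1)
    rw [Finset.sum_range_succ, show 2 * (k + 1) + 1 = 2 * k + 3 by ring]
    rw [show 2 * (k + 1) = 2 * k + 2 by ring] at h0 ⊢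
    push_cast
    rw [show 2 * (2 * ((k : ℝ) + 1) + 1) = 2 * (2 * k + 3) by ring]
    linear_combination -2 * h + 2 * h0 + ih

theorem even_L2_recursion (k : ℕ) :
    Veven (k + 1)
      = -(1 / (2 * (k : ℝ) + 2))
        + (Real.sqrt 2 / ((k : ℝ) + 1)) * (∑ i ∈ Finset.range (k + 1), genBinom (-(1 / 2)) i)
        + ((2 * (k : ℝ) + 1) / (2 * (k : ℝ) + 2)) * Veven k := by
  have hV : ∀ j, Veven j = ∫ x in Ioi (0 : ℝ), hermiteTail (2 * j) x * hermiteTail (2 * j) x := by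
    intro j
    simp only [Veven, hermiteTail, sq]
  have eA := ((expDecay_hermiteTail (2 * k)).mul (expDecay_hermiteTail (2 * k))).const_mul
    ((2 * k + 1) / (2 * k + 2))
  have eB := ((expDecay_hermiteTail (2 * k)).mul (expDecay_hermiteFun (2 * k + 1))).const_mul
    (2 * √(2 * (2 * k + 1)) / (2 * k + 2))
  have eC := ((expDecay_hermiteFun (2 * k + 1)).mul (expDecay_hermiteFun (2 * k + 1))).const_mul
    (2 / (2 * k + 2))
  have hsq : ∀ x, hermiteTail (2 * (k + 1)) x * hermiteTail (2 * (k + 1)) x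
      = (2 * k + 1) / (2 * k + 2) * (hermiteTail (2 * k) x * hermiteTail (2 * k) x)
        + 2 * √(2 * (2 * k + 1)) / (2 * k + 2) * (hermiteTail (2 * k) x * hermiteFun (2 * k + 1) x)
        + 2 / (2 * k + 2) * (hermiteFun (2 * k + 1) x * hermiteFun (2 * k + 1) x) := by
    intro x
    have h := congrArg (· ^ 2) (hermiteTail_add_two (2 * k) x)
    have s1 : √(2 * (2 * (k : ℝ) + 1)) ^ 2 = 2 * (2 * k + 1) := Real.sq_sqrt (by positivity)
    have s2 : √(2 * (2 * (k : ℝ) + 2)) ^ 2 = 2 * (2 * k + 2) := Real.sq_sqrt (by positivity)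
    push_cast at h
    rw [mul_pow, s2] at h
    rw [show 2 * (k + 1) = 2 * k + 2 by ring]
    field_simp
    linear_combination h / 2 + s1 / 2 * hermiteTail (2 * k) x ^ 2
  have hI := integral_hermiteTail_mul_hermiteFun_succ k
  rw [hV, hV]
  simp_rw [hsq]
  rw [integral_add ((eA.add eB).integrableOn 0) (eC.integrableOn 0),
    integral_add (eA.integrableOn 0) (eB.integrableOn 0), integral_const_mul, integral_const_mul,
    integral_const_mul, integral_hermiteFun_sq]
  have hk : (k : ℝ) + 1 ≠ 0 := by positivity
  field_simp
  linear_combination 2 * hI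
end
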